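/- For all (a,b,c) ∈ K³, N(Ω(a,b,c)) = N(a,b,c)^{2θ+3}, where Ω(a,b,c) = (−v, −u·w^θ, −c·w^{θ+1}) with v = a^θ b^θ − c^θ + a b² + b c − a^{2θ+3}, u = a² b − a c + b^θ − a^{θ+3}, and w = N(a,b,c). -/

import Mathlib

/-- The norm of a Ree group. -/
def ReeNorm {K : Type*} [Field K] (θ : K →+* K) (a b c : K) : K :=
  -a * θ c + θ a * a * θ b - θ a * a ^ 3 * b - a ^ 2 * b ^ 2 + θ b * b + c ^ 2
    - (θ a) ^ 2 * a ^ 4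

/-- `N(Ω(a,b,c)) = N(a,b,c)^{2θ+3}` where `Ω(a,b,c) = (−v, −u·w^θ, −c·w^{θ+1})`. -/
theorem stmt5 {K : Type*} [Field K] [CharP K 3] (θ : K →+* K)
    (hθ : ∀ x : K, θ (θ x) = x ^ 3) (a b c v u w : K)
    (hv : v = θ a * θ b - θ c + a * b ^ 2 + b * c - (θ a) ^ 2 * a ^ 3)
    (hu : u = a ^ 2 * b - a * c + θ b - θ a * a ^ 3)
    (hw : w = ReeNorm θ a b c) :
    ReeNorm θ (-v) (-u * θ w) (-c * (θ w * w)) = (θ w) ^ 2 * w ^ 3 := by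
  have h3 : (3 : K) = 0 := by exact_mod_cast CharP.cast_eq_zero K 3
  unfold ReeNorm at hw
  obtain ⟨A, hA⟩ : ∃ A, A = θ a := ⟨_, rfl⟩
  obtain ⟨B, hB⟩ : ∃ B, B = θ b := ⟨_, rfl⟩
  obtain ⟨C, hC⟩ : ∃ C, C = θ c := ⟨_, rfl⟩
  have hAA : θ A = a ^ 3 := by rw [hA, hθ]
  have hBB : θ B = b ^ 3 := by rw [hB, hθ]
  have hCC : θ C = c ^ 3 := by rw [hC, hθ]
  have hWW : θ (θ w) = w ^ 3 := hθ w
  rw [← hA, ← hB, ← hC] at hv hw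
  rw [← hA, ← hB] at hu
  obtain ⟨V, hV⟩ : ∃ V, V = θ v := ⟨_, rfl⟩
  obtain ⟨U, hU⟩ : ∃ U, U = θ u := ⟨_, rfl⟩
  obtain ⟨W, hW⟩ : ∃ W, W = θ w := ⟨_, rfl⟩
  have hV' : V = a ^ 3 * b ^ 3 - c ^ 3 + A * B ^ 2 + B * C - a ^ 6 * A ^ 3 := by
    rw [hV, hv]
    simp only [map_add, map_sub, map_mul, map_pow, ← hA, ← hB, ← hC, hAA, hBB, hCC]
    ring
  have hU' : U = A ^ 2 * B - A * C + b ^ 3 - a ^ 3 * A ^ 3 := by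
    rw [hU, hu]
    simp only [map_add, map_sub, map_mul, map_pow, ← hA, ← hB, ← hC, hAA, hBB]
  have hW' : W = -A * c ^ 3 + a ^ 3 * A * b ^ 3 - a ^ 3 * A ^ 3 * B - A ^ 2 * B ^ 2
      + b ^ 3 * B + C ^ 2 - a ^ 6 * A ^ 4 := by
    rw [hW, hw]
    simp only [map_add, map_sub, map_mul, map_pow, map_neg, ← hA, ← hB, ← hC, hAA, hBB, hCC]
    ring
  obtain ⟨q, hq⟩ : ∃ q, q = a^5*A^3 -a^3*c*A^2 -a^2*b^3 -a^2*b*c*A -a^2*A^2*B +a^2*A*C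
      -a*b^2*c -a*b*C +a*c^2*A +b^2*B -b*c^2 +c*A*B +c*C := ⟨_, rfl⟩
  obtain ⟨p, hp⟩ : ∃ p, p = a^4*A^3 -a^3*b*A^2 -a^2*b^2*A +a*b^3 +a*b*c*A -a*A^2*B +a*A*C
      -b^2*c +b*A*B -b*C -c^2*A := ⟨_, rfl⟩
  obtain ⟨s, hs⟩ : ∃ s, s = a*b*A -b^2 +c*A := ⟨_, rfl⟩
  have I1 : V * v + u * W = w * q := by
    clear hA hB hC hAA hBB hCC hWW hV hU hW hθ
    subst hv hu hw hV' hU' hW' hq hp hs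
    grind
  have I2 : c * W + v * q = w * p := by
    clear hA hB hC hAA hBB hCC hWW hV hU hW hθ I1
    subst hv hu hw hV' hU' hW' hq hp hs
    grind
  have I3 : p * c + v * C + U * u + W = w * s := by
    clear hA hB hC hAA hBB hCC hWW hV hU hW hθ I1 I2
    subst hv hu hw hV' hU' hW' hq hp hs
    grind
  have I4 : p ^ 2 + U * q + W * s = 0 := by
    clear hA hB hC hAA hBB hCC hWW hV hU hW hθ I1 I2 I3
    subst hv hu hw hV' hU' hW' hq hp hs
    grind
  unfold ReeNorm
  simp only [map_neg, map_mul, ← hV, ← hU, ← hW, ← hC]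
  rw [hW, hWW, ← hW]
  linear_combination (-v ^ 2 * (V * v + u * W + w * q) - U * w ^ 3) * I1
    + (w ^ 2 * (c * W - v * q) - w ^ 3 * p) * I2 - w ^ 3 * W * I3 - w ^ 4 * I4
    + (v ^ 3 * V * u * W + w ^ 3 * (p * c * W + U * u * W)) * h3
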